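/- Fix d ≥ 1 and M > 0. Define W₁ ∈ ℝ^{4d×(d+1)} as the block matrix with rows of blocks [I_d, M·1_d], [−I_d, M·1_d], [I_d, −M·1_d], [−I_d, −M·1_d] (where 1_d is the all-ones column vector), b₁ = −M·1_{4d} ∈ ℝ^{4d}, and W₂ = [I_d, −I_d, −I_d, I_d] ∈ ℝ^{d×4d}. Then for every y ∈ {−1, 1} and every x ∈ ℝ^d with ‖x‖_∞ ≤ M, one has W₂ · ReLU( W₁·(x; y) + b₁ ) = y·x, where (x; y) ∈ ℝ^{d+1} is the concatenation of x and y and ReLU is applied entrywise (ReLU(t) = max{t, 0}). -/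

import Mathlib

open Matrix

noncomputable section

/-- The matrix `W₁ ∈ ℝ^{4d×(d+1)}` with rows of blocks
`[I_d, M·1_d], [−I_d, M·1_d], [I_d, −M·1_d], [−I_d, −M·1_d]`; rows are indexed by
`Fin 4 × Fin d` (the first component selects the block) and columns by `Fin d ⊕ Unit`
(the last column corresponding to the label entry). -/
def embedW1 (d : ℕ) (M : ℝ) : Matrix (Fin 4 × Fin d) (Fin d ⊕ Unit) ℝ :=
  Matrix.of fun p c =>
    Sum.elim
      (fun j => (if p.1 = 0 ∨ p.1 = 2 then (1 : ℝ) else -1) * (if p.2 = j then 1 else 0))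
      (fun _ => if p.1 = 0 ∨ p.1 = 1 then M else -M) c

/-- The bias `b₁ = −M·1_{4d}`. -/
def embedB1 (d : ℕ) (M : ℝ) : Fin 4 × Fin d → ℝ := fun _ => -M

/-- The matrix `W₂ = [I_d, −I_d, −I_d, I_d] ∈ ℝ^{d×4d}`. -/
def embedW2 (d : ℕ) : Matrix (Fin d) (Fin 4 × Fin d) ℝ :=
  Matrix.of fun j p =>
    (if p.1 = 0 ∨ p.1 = 3 then (1 : ℝ) else -1) * (if j = p.2 then 1 else 0)

theorem embedW1_mulVec_elim (d : ℕ) (M y : ℝ) (x : Fin d → ℝ) (p : Fin 4 × Fin d) :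
    (embedW1 d M).mulVec (Sum.elim x fun _ => y) p =
      (if p.1 = 0 ∨ p.1 = 2 then (1 : ℝ) else -1) * x p.2 +
        (if p.1 = 0 ∨ p.1 = 1 then M else -M) * y := by
  simp [embedW1, mulVec, dotProduct]

theorem embedW2_mulVec (d : ℕ) (v : Fin 4 × Fin d → ℝ) (j : Fin d) :
    (embedW2 d).mulVec v j = v (0, j) - v (1, j) - v (2, j) + v (3, j) := by
  simp [embedW2, mulVec, dotProduct, Fintype.sum_prod_type, Fin.sum_univ_four]
  ring

/-- For every `y ∈ {−1, 1}` and every `x` with `‖x‖_∞ ≤ M`,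
`W₂ · ReLU(W₁ · (x; y) + b₁) = y·x`, where `ReLU(t) = max{t, 0}` entrywise. -/
theorem statement9 (d : ℕ) (hd : 1 ≤ d) (M : ℝ) (hM : 0 < M)
    (y : ℝ) (hy : y = -1 ∨ y = 1) (x : Fin d → ℝ) (hx : ∀ j, |x j| ≤ M) :
    (embedW2 d).mulVec
        (fun r => max ((embedW1 d M).mulVec (Sum.elim x fun _ => y) r + embedB1 d M r) 0) =
      y • x := by
  ext j
  obtain ⟨hl, hu⟩ := abs_le.mp (hx j)
  simp only [embedW2_mulVec, embedW1_mulVec_elim, embedB1, Pi.smul_apply, smul_eq_mul]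
  rcases hy with rfl | rfl <;> simp <;> grind
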